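/- arXiv:1709.02850 — 10 statements merged into one kernel-verified Lean document; each statement's English description precedes it below -/
import Mathlib

section
/- Fix N m : ℕ. For each i : Fin N and j : Fin m, let ℓf i j, ℓg i j : ℕ, let ρf i j : Fin (ℓf i j) → ℝ and ρg i j : Fin (ℓg i j) → ℝ, let df i j : Fin (ℓf i j + 1) → ℝ be monotone nondecreasing and dg i j : Fin (ℓg i j + 1) → ℝ be monotone nonincreasing, and define F i j (x) = df i j 0 · x + ∑_{k} (df i j (k+1) − df i j k) · max 0 (x − ρf i j k) and G i j (x) = dg i j 0 · x + ∑_{k} (dg i j (k+1) − dg i j k) · max 0 (x − ρg i j k). Let b : Fin m → ℝ. Then for every x : Fin N → ℝ, the following are equivalent: (1) for every j, ∑_i F i j (x i) ≤ ∑_i G i j (x i) + b j; (2) there exist w u : Fin N → Fin m → ℝ and families z i j : Fin (ℓf i j) → ℝ and y i j : Fin (ℓg i j) → ℝ such that for every j, ∑_i w i j ≤ ∑_i u i j + b j; for all i, j, k, 0 ≤ z i j k and x i − ρf i j k ≤ z i j k, and 0 ≤ y i j k and x i − ρg i j k ≤ y i j k; for all i, j, df i j 0 · x i + ∑_k (df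 i j (k+1) − df i j k) · z i j k ≤ w i j; and for all i, j, u i j ≤ dg i j 0 · x i + ∑_k (dg i j (k+1) − dg i j k) · y i j k. (Correctness of the paper's transformation of a mixed integer program with piecewise linear convex/concave transformations into an ordinary mixed integer program; since the equivalence holds pointwise in x, it preserves integrality constraints on any subset of the variables.) -/
/-- Correctness of the transformation of a mixed integer program with piecewise linear
convex/concave transformations into an ordinary mixed integer program: for every
assignment `x` of the original variables, the nonlinear constraints are satisfiable
iff the linearized system with auxiliary real variables `w`, `u`, `z`, `y` is. -/
theorem eMIP_to_MIP_correct (N m : ℕ) (ℓf ℓg : Fin N → Fin m → ℕ)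
    (ρf : ∀ (i : Fin N) (j : Fin m), Fin (ℓf i j) → ℝ)
    (ρg : ∀ (i : Fin N) (j : Fin m), Fin (ℓg i j) → ℝ)
    (df : ∀ (i : Fin N) (j : Fin m), Fin (ℓf i j + 1) → ℝ)
    (dg : ∀ (i : Fin N) (j : Fin m), Fin (ℓg i j + 1) → ℝ)
    (hdf : ∀ i j, Monotone (df i j)) (hdg : ∀ i j, Antitone (dg i j))
    (b : Fin m → ℝ) (x : Fin N → ℝ) :
    (∀ j : Fin m,
        ∑ i : Fin N, (df i j 0 * x i +
            ∑ k : Fin (ℓf i j), (df i j k.succ - df i j k.castSucc) * max 0 (x i - ρf i j k)) ≤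
        (∑ i : Fin N, (dg i j 0 * x i +
            ∑ k : Fin (ℓg i j), (dg i j k.succ - dg i j k.castSucc) * max 0 (x i - ρg i j k)))
          + b j) ↔
      ∃ (w u : Fin N → Fin m → ℝ)
        (z : ∀ (i : Fin N) (j : Fin m), Fin (ℓf i j) → ℝ)
        (y : ∀ (i : Fin N) (j : Fin m), Fin (ℓg i j) → ℝ),
        (∀ j : Fin m, ∑ i : Fin N, w i j ≤ (∑ i : Fin N, u i j) + b j) ∧
        (∀ (i : Fin N) (j : Fin m) (k : Fin (ℓf i j)),
            0 ≤ z i j k ∧ x i - ρf i j k ≤ z i j k) ∧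
        (∀ (i : Fin N) (j : Fin m) (k : Fin (ℓg i j)),
            0 ≤ y i j k ∧ x i - ρg i j k ≤ y i j k) ∧
        (∀ (i : Fin N) (j : Fin m),
            df i j 0 * x i +
              ∑ k : Fin (ℓf i j), (df i j k.succ - df i j k.castSucc) * z i j k ≤ w i j) ∧
        (∀ (i : Fin N) (j : Fin m),
            u i j ≤ dg i j 0 * x i +
              ∑ k : Fin (ℓg i j), (dg i j k.succ - dg i j k.castSucc) * y i j k) := by
  constructor
  · intro h
    exact ⟨_, _, fun i j k => max 0 (x i - ρf i j k), fun i j k => max 0 (x i - ρg i j k), h,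
      fun _ _ _ => ⟨le_max_left _ _, le_max_right _ _⟩,
      fun _ _ _ => ⟨le_max_left _ _, le_max_right _ _⟩,
      fun _ _ => le_rfl, fun _ _ => le_rfl⟩
  · rintro ⟨w, u, z, y, hwu, hz, hy, hw, hu⟩ j
    calc
      _ ≤ ∑ i : Fin N, w i j := Finset.sum_le_sum fun i _ => le_trans
        (add_le_add_right (Finset.sum_le_sum fun k _ => mul_le_mul_of_nonneg_left
          (max_le (hz i j k).1 (hz i j k).2)
          (sub_nonneg.2 (hdf i j k.castSucc_lt_succ.le))) _) (hw i j)
      _ ≤ (∑ i : Fin N, u i j) + b j := hwu j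
      _ ≤ _ := add_le_add_left (Finset.sum_le_sum fun i _ => le_trans (hu i j)
        (add_le_add_right (Finset.sum_le_sum fun k _ => mul_le_mul_of_nonpos_left
          (max_le (hy i j k).1 (hy i j k).2)
          (sub_nonpos.2 (hdg i j k.castSucc_lt_succ.le))) _)) _
end

section
/- Let n K T : ℕ with 2 ≤ n and 1 ≤ T, and let k : Fin (2·n) → ℕ satisfy 1 ≤ k i and k i ≤ K for all i. Then the following are equivalent: (1) there exists a set I ⊆ Fin (2·n) with |I| = n and ∑_{i ∈ I} k i = T; (2) there exists a set J ⊆ Fin (2·n) with |J| ≤ n such that T ≤ ∑_{i ∈ J} k i and n²·K·T − T ≤ ∑_{i ∈ J} (n·K·T − k i), where the arithmetic is carried out in the integers ℤ. (Correctness of the reduction showing Multiset Multicover is NP-hard for universes of size two.) -/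
/-- Correctness of the reduction showing Multiset Multicover is NP-hard for universes
of size two: choosing exactly `n` of the `2n` numbers summing to `T` is equivalent to
choosing at most `n` multisets meeting both covering requirements. -/
theorem multiset_multicover_two_elements_reduction (n K T : ℕ) (hn : 2 ≤ n) (hT : 1 ≤ T)
    (k : Fin (2 * n) → ℕ) (hk : ∀ i, 1 ≤ k i ∧ k i ≤ K) :
    (∃ I : Finset (Fin (2 * n)), I.card = n ∧ ∑ i ∈ I, k i = T) ↔
      ∃ J : Finset (Fin (2 * n)), J.card ≤ n ∧
        (T : ℤ) ≤ ∑ i ∈ J, (k i : ℤ) ∧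
        (n : ℤ) ^ 2 * K * T - T ≤ ∑ i ∈ J, ((n : ℤ) * K * T - (k i : ℤ)) := by
  have sum_eq (J : Finset (Fin (2 * n))) :
      ∑ i ∈ J, ((n : ℤ) * K * T - (k i : ℤ)) = J.card * (n * K * T) - ∑ i ∈ J, (k i : ℤ) := by
    simp [Finset.sum_sub_distrib]
  simp only [sum_eq]
  constructor
  · rintro ⟨I, hI, hsum⟩
    have hsum' : ∑ i ∈ I, (k i : ℤ) = T := by exact_mod_cast hsum
    refine ⟨I, hI.le, hsum'.ge, ?_⟩
    rw [hsum', hI]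
    exact le_of_eq (by ring)
  · rintro ⟨J, hJ, hlow, hhigh⟩
    have hK : 1 ≤ K := (hk ⟨0, by omega⟩).1.trans (hk ⟨0, by omega⟩).2
    have hpos : (0 : ℤ) < n * K * T := by
      have : 0 < n * K * T := by positivity
      exact_mod_cast this
    have hcard : J.card = n := by
      by_contra hne
      have hlt : (0 : ℤ) < n - J.card := by omega
      nlinarith [mul_pos hlt hpos]
    refine ⟨J, hcard, ?_⟩
    rw [hcard] at hhigh
    have hsum : ∑ i ∈ J, (k i : ℤ) = T := le_antisymm (by linarith) hlow
    exact_mod_cast hsum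
end

section
/- Let U be a finite type, n B : ℕ, S : Fin n → Finset U, w : Fin n → ℕ, and r : U → ℕ. For A : Finset U let 𝒮(A) = {j : Fin n | S j = A}, and for k ≤ |𝒮(A)| let cost A k be the minimum of ∑_{j ∈ T} w j over sets T ⊆ 𝒮(A) with |T| = k. Then the following are equivalent: (1) there exists a set T ⊆ Fin n with ∑_{j ∈ T} w j ≤ B such that for every x : U, r x ≤ |{j ∈ T | x ∈ S j}|; (2) there exists z : Finset U → ℕ such that z A ≤ |𝒮(A)| for every A ⊆ U, for every x : U one has r x ≤ ∑_{A ⊆ U, x ∈ A} z A, and ∑_{A ⊆ U} cost A (z A) ≤ B. (Grouping sets by type and charging each type its cheapest z A sets is exact for Weighted Set Multicover; this underlies the paper's FPT algorithm parameterized by |U|.) -/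
open Finset

/-- The members of a subfamily covering `x`, counted by type. -/
theorem card_filter_mem_eq_sum_card_filter_eq {ι U : Type*} [Fintype U] [DecidableEq U]
    (S : ι → Finset U) (T : Finset ι) (x : U) :
    (T.filter fun j => x ∈ S j).card =
      ∑ A ∈ univ.filter (fun A : Finset U => x ∈ A), (T.filter fun j => S j = A).card := by
  rw [card_eq_sum_card_fiberwise (f := S) (t := univ.filter fun A : Finset U => x ∈ A)
    (fun j hj => by simpa using (mem_filter.1 hj).2)]
  refine sum_congr rfl fun A hA => ?_
  rw [filter_filter]
  congr 1
  refine filter_congr fun j _ => and_iff_right_of_imp ?_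
  rintro rfl
  exact (mem_filter.1 hA).2

/-- Grouping sets by type and charging each type its cheapest `z A` sets is exact
for Weighted Set Multicover. -/
theorem weighted_set_multicover_grouping (U : Type*) [Fintype U] [DecidableEq U]
    (n B : ℕ) (S : Fin n → Finset U) (w : Fin n → ℕ) (r : U → ℕ)
    (cost : Finset U → ℕ → ℕ)
    (hcost : ∀ (A : Finset U) (k : ℕ), k ≤ (univ.filter fun j => S j = A).card →
      IsLeast {s : ℕ | ∃ T : Finset (Fin n),
        T ⊆ univ.filter (fun j => S j = A) ∧ T.card = k ∧ ∑ j ∈ T, w j = s} (cost A k)) :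
    (∃ T : Finset (Fin n), ∑ j ∈ T, w j ≤ B ∧
        ∀ x : U, r x ≤ (T.filter fun j => x ∈ S j).card) ↔
      ∃ z : Finset U → ℕ,
        (∀ A : Finset U, z A ≤ (univ.filter fun j => S j = A).card) ∧
        (∀ x : U, r x ≤ ∑ A ∈ univ.filter (fun A : Finset U => x ∈ A), z A) ∧
        ∑ A : Finset U, cost A (z A) ≤ B := by
  constructor
  · rintro ⟨T, hw, hr⟩
    have hz (A : Finset U) :
        T.filter (fun j => S j = A) ⊆ univ.filter fun j => S j = A :=
      filter_subset_filter _ (subset_univ T)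
    refine ⟨fun A => (T.filter fun j => S j = A).card, fun A => card_le_card (hz A),
      fun x => (hr x).trans_eq (card_filter_mem_eq_sum_card_filter_eq S T x), ?_⟩
    calc ∑ A : Finset U, cost A (T.filter fun j => S j = A).card
        ≤ ∑ A : Finset U, ∑ j ∈ T.filter (fun j => S j = A), w j :=
          sum_le_sum fun A _ => (hcost A _ (card_le_card (hz A))).2 ⟨_, hz A, rfl, rfl⟩
      _ = ∑ j ∈ T, w j := sum_fiberwise T S w
      _ ≤ B := hw
  · rintro ⟨z, hz, hr, hB⟩
    choose F hF hcard hsum using fun A => (hcost A (z A) (hz A)).1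
    have hfiber (A : Finset U) :
        (univ.filter fun j => j ∈ F (S j)).filter (fun j => S j = A) = F A := by
      ext j
      simp only [mem_filter, mem_univ, true_and]
      constructor
      · rintro ⟨hj, rfl⟩
        exact hj
      · intro hj
        obtain rfl : S j = A := (mem_filter.1 (hF A hj)).2
        exact ⟨hj, rfl⟩
    refine ⟨univ.filter fun j => j ∈ F (S j), ?_, fun x => ?_⟩
    · rw [← sum_fiberwise _ S w]
      simpa only [hfiber, hsum] using hB
    · rw [card_filter_mem_eq_sum_card_filter_eq]
      simpa only [hfiber, hcard] using hr x
end

section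
/- Let U be a finite type, n B : ℕ, A : Fin n → Finset U, t : Fin n → ℕ, and r : U → ℕ. For A' : Finset U let 𝒮(A') = {j : Fin n | A j = A'}, and for k ≤ |𝒮(A')| let gain A' k be the maximum of ∑_{j ∈ T} t j over sets T ⊆ 𝒮(A') with |T| = k. Then the following are equivalent: (1) there exists a set T ⊆ Fin n with |T| ≤ B such that for every x : U, r x ≤ ∑_{j ∈ T, x ∈ A j} t j; (2) there exists z : Finset U → ℕ such that z A' ≤ |𝒮(A')| for every A' ⊆ U, ∑_{A' ⊆ U} z A' ≤ B, and for every x : U one has r x ≤ ∑_{A' ⊆ U, x ∈ A'} gain A' (z A'). (Grouping uniform multisets by support and taking, for each support, the sets with largest multiplicities is exact for Uniform Multiset Multicover; this underlies the paper's FPT algorithm parameterized by |U|.) -/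
open Finset

/-- A sum over the members of `T` whose image satisfies `p` can be computed fibre by fibre. -/
theorem sum_filter_comp_eq_sum_fiber {ι κ M : Type*} [Fintype κ] [DecidableEq κ]
    [AddCommMonoid M] (T : Finset ι) (A : ι → κ) (t : ι → M) (p : κ → Prop) [DecidablePred p] :
    ∑ j ∈ T.filter (fun j => p (A j)), t j =
      ∑ a ∈ univ.filter p, ∑ j ∈ T.filter (fun j => A j = a), t j := by
  rw [← sum_fiberwise_of_maps_to (t := univ.filter p) (g := A) (by simp)]
  refine sum_congr rfl fun a ha => sum_congr ?_ fun _ _ => rfl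
  ext j
  simp only [mem_filter, mem_univ, true_and] at ha ⊢
  grind

/-- Grouping uniform multisets by support and taking, for each support, the sets with
largest multiplicities is exact for Uniform Multiset Multicover. -/
theorem uniform_multiset_multicover_grouping (U : Type*) [Fintype U] [DecidableEq U]
    (n B : ℕ) (A : Fin n → Finset U) (t : Fin n → ℕ) (r : U → ℕ)
    (gain : Finset U → ℕ → ℕ)
    (hgain : ∀ (A' : Finset U) (k : ℕ), k ≤ (univ.filter fun j => A j = A').card →
      IsGreatest {s : ℕ | ∃ T : Finset (Fin n),
        T ⊆ univ.filter (fun j => A j = A') ∧ T.card = k ∧ ∑ j ∈ T, t j = s} (gain A' k)) :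
    (∃ T : Finset (Fin n), T.card ≤ B ∧
        ∀ x : U, r x ≤ ∑ j ∈ T.filter (fun j => x ∈ A j), t j) ↔
      ∃ z : Finset U → ℕ,
        (∀ A' : Finset U, z A' ≤ (univ.filter fun j => A j = A').card) ∧
        (∑ A' : Finset U, z A') ≤ B ∧
        (∀ x : U, r x ≤ ∑ A' ∈ univ.filter (fun A' : Finset U => x ∈ A'), gain A' (z A')) := by
  constructor
  · rintro ⟨T, hTB, hT⟩
    have hsub (A' : Finset U) :
        T.filter (fun j => A j = A') ⊆ univ.filter (fun j => A j = A') :=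
      filter_subset_filter _ (subset_univ T)
    refine ⟨fun A' => (T.filter fun j => A j = A').card, fun A' => card_le_card (hsub A'), ?_,
      fun x => (hT x).trans ?_⟩
    · rwa [← card_eq_sum_card_fiberwise fun j _ => mem_coe.2 (mem_univ (A j))]
    · rw [sum_filter_comp_eq_sum_fiber T A t (fun A' => x ∈ A')]
      exact sum_le_sum fun A' _ =>
        (hgain A' _ (card_le_card (hsub A'))).2 ⟨_, hsub A', rfl, rfl⟩
  · rintro ⟨z, hz, hzB, hzr⟩
    choose S hS hcard hsum using fun A' => (hgain A' (z A') (hz A')).1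
    have hfiber (A' : Finset U) :
        (univ.filter fun j => j ∈ S (A j)).filter (fun j => A j = A') = S A' := by
      ext j
      have := @hS A' j
      simp only [mem_filter, mem_univ, true_and] at this ⊢
      grind
    refine ⟨univ.filter fun j => j ∈ S (A j), ?_, fun x => (hzr x).trans ?_⟩
    · rw [card_eq_sum_card_fiberwise fun j _ => mem_coe.2 (mem_univ (A j))]
      simpa only [hfiber, hcard] using hzB
    · rw [sum_filter_comp_eq_sum_fiber _ A t (fun A' => x ∈ A')]
      simp only [hfiber, hsum, le_refl]
end

section
/- Let C be a finite type with a distinguished candidate p : C, let n B : ℕ, let v : Fin n → Finset C (the approval sets of the voters), and let π : Fin n → ℕ (the deletion prices). Then the following are equivalent: (1) there exists a set D ⊆ Fin n with ∑_{i ∈ D} π i ≤ B such that for every c : C, |{i ∉ D | c ∈ v i}| ≤ |{i ∉ D | p ∈ v i}|; (2) there exists a set D ⊆ Fin n with p ∉ v i for every i ∈ D, with ∑_{i ∈ D} π i ≤ B, such that for every c : C, |{i | c ∈ v i}| ≤ |{i | p ∈ v i}| + |{i ∈ D | c ∈ v i}|. (Correctness of the reduction of Approval-$CCDV to Weighted Set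 Multicover: it is never useful to delete voters who approve p, and making p a winner by deletions is equivalent to covering each candidate's score excess.) -/
open Finset

/-- A candidate's score splits into the approvals from voters kept and voters deleted. -/
theorem card_filter_notMem_add_card_filter {ι : Type*} [Fintype ι] [DecidableEq ι]
    (D : Finset ι) (q : ι → Prop) [DecidablePred q] :
    (univ.filter fun i => i ∉ D ∧ q i).card + (D.filter q).card = (univ.filter q).card := by
  rw [← card_filter_add_card_filter_not (s := univ.filter q) (· ∈ D), add_comm, filter_filter,
    filter_filter]
  congr 2 <;> ext i <;> simp [and_comm]

/-- Correctness of the reduction of Approval-$CCDV to Weighted Set Multicover: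
it is never useful to delete voters who approve `p`, and making `p` a winner by
deletions is equivalent to covering each candidate's score excess. -/
theorem approval_priced_ccdv_reduction (C : Type*) [Fintype C] [DecidableEq C] (p : C)
    (n B : ℕ) (v : Fin n → Finset C) (π : Fin n → ℕ) :
    (∃ D : Finset (Fin n), ∑ i ∈ D, π i ≤ B ∧
        ∀ c : C, (univ.filter fun i => i ∉ D ∧ c ∈ v i).card ≤
          (univ.filter fun i => i ∉ D ∧ p ∈ v i).card) ↔
      ∃ D : Finset (Fin n), (∀ i ∈ D, p ∉ v i) ∧ ∑ i ∈ D, π i ≤ B ∧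
        ∀ c : C, (univ.filter fun i => c ∈ v i).card ≤
          (univ.filter fun i => p ∈ v i).card + (D.filter fun i => c ∈ v i).card := by
  have score_split (D : Finset (Fin n)) (c : C) :=
    card_filter_notMem_add_card_filter D fun i => c ∈ v i
  constructor
  · rintro ⟨D, hB, hD⟩
    refine ⟨D.filter fun i => p ∉ v i, fun i hi => (mem_filter.mp hi).2,
      (sum_le_sum_of_subset (filter_subset _ _)).trans hB, fun c => ?_⟩
    have hcover : (D.filter fun i => c ∈ v i).card ≤
        (D.filter fun i => p ∈ v i).card +
          ((D.filter fun i => p ∉ v i).filter fun i => c ∈ v i).card := by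
      refine (card_le_card fun i hi => ?_).trans (card_union_le _ _)
      simp only [mem_union, mem_filter] at hi ⊢
      tauto
    have hc := score_split D c
    have hp := score_split D p
    have hwin := hD c
    omega
  · rintro ⟨D, hp, hB, hD⟩
    refine ⟨D, hB, fun c => ?_⟩
    have hDp : (D.filter fun i => p ∈ v i).card = 0 := by
      rw [card_eq_zero, filter_eq_empty_iff]
      exact hp
    have hc := score_split D c
    have hsp := score_split D p
    have hcover := hD c
    omega
end

section
/- Let C be a finite type with a distinguished candidate p : C, let n n' B : ℕ, let v : Fin n → Finset C (the registered voters' approval sets), q : Fin n' → Finset C (the unregistered voters' approval sets), and π : Fin n' → ℕ (the addition prices). Write score(c) = |{i : Fin n | c ∈ v i}|. Then the following are equivalent: (1) there exists a set W ⊆ Fin n' with ∑_{w ∈ W} π w ≤ B such that for every c : C, score(c) + |{w ∈ W | c ∈ q w}| ≤ score(p) + |{w ∈ W | p ∈ q w}|; (2) there exists a set W ⊆ Fin n' with p ∈ q w for every w ∈ W, with ∑_{w ∈ W} π w ≤ B, such that for every c : C, score(c) ≤ score(p) + |{w ∈ W | c ∉ q w}|. (Correctness of the reduction of Approval-$CCAV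 to Weighted Set Multicover: it is never useful to add voters who do not approve p.) -/
open Finset

/-- Correctness of the reduction of Approval-$CCAV to Weighted Set Multicover:
it is never useful to add voters who do not approve `p`. -/
theorem approval_priced_ccav_reduction (C : Type*) [Fintype C] [DecidableEq C] (p : C)
    (n n' B : ℕ) (v : Fin n → Finset C) (q : Fin n' → Finset C) (π : Fin n' → ℕ) :
    (∃ W : Finset (Fin n'), ∑ w ∈ W, π w ≤ B ∧
        ∀ c : C, (univ.filter fun i => c ∈ v i).card + (W.filter fun w => c ∈ q w).card ≤
          (univ.filter fun i => p ∈ v i).card + (W.filter fun w => p ∈ q w).card) ↔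
      ∃ W : Finset (Fin n'), (∀ w ∈ W, p ∈ q w) ∧ ∑ w ∈ W, π w ≤ B ∧
        ∀ c : C, (univ.filter fun i => c ∈ v i).card ≤
          (univ.filter fun i => p ∈ v i).card + (W.filter fun w => c ∉ q w).card := by
  constructor
  · rintro ⟨W, hB, hW⟩
    refine ⟨W.filter fun w => p ∈ q w, fun w hw => (mem_filter.1 hw).2,
      (sum_le_sum_of_subset (filter_subset _ W)).trans hB, fun c => ?_⟩
    have hc := hW c
    have hsplit := card_filter_add_card_filter_not (s := W.filter fun w => p ∈ q w)
      (fun w => c ∈ q w)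
    have hle : ((W.filter fun w => p ∈ q w).filter fun w => c ∈ q w).card ≤
        (W.filter fun w => c ∈ q w).card :=
      card_le_card (filter_subset_filter _ (filter_subset _ W))
    omega
  · rintro ⟨W, hp, hB, hW⟩
    refine ⟨W, hB, fun c => ?_⟩
    have hc := hW c
    have hsplit := card_filter_add_card_filter_not (s := W) (fun w => c ∈ q w)
    rw [filter_true_of_mem hp]
    omega
end

section
/- Let C be a finite type with a distinguished candidate p : C, let n B : ℕ, let v : Fin n → Finset C (the approval sets of the voters), and let π : Fin n → ℕ (the bribery prices). Then the following are equivalent: (1) there exists v' : Fin n → Finset C with ∑_{i : v' i ≠ v i} π i ≤ B such that for every c : C, |{i | c ∈ v' i}| ≤ |{i | p ∈ v' i}|; (2) there exists a set W ⊆ Fin n with ∑_{i ∈ W} π i ≤ B such that for every c : C with c ≠ p, |{i ∉ W | c ∈ v i}| ≤ |{i | p ∈ v i} ∪ W|. (Correctness of the reduction of Approval-$Bribery: without loss of generality every bribed voter ends up approving only p.) -/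
open Finset

/-- Correctness of the reduction of Approval-$Bribery: without loss of generality
every bribed voter ends up approving only `p`. -/
theorem approval_priced_bribery_reduction (C : Type*) [Fintype C] [DecidableEq C] (p : C)
    (n B : ℕ) (v : Fin n → Finset C) (π : Fin n → ℕ) :
    (∃ v' : Fin n → Finset C, ∑ i ∈ univ.filter (fun i => v' i ≠ v i), π i ≤ B ∧
        ∀ c : C, (univ.filter fun i => c ∈ v' i).card ≤ (univ.filter fun i => p ∈ v' i).card) ↔
      ∃ W : Finset (Fin n), ∑ i ∈ W, π i ≤ B ∧
        ∀ c : C, c ≠ p → (univ.filter fun i => i ∉ W ∧ c ∈ v i).card ≤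
          ((univ.filter fun i => p ∈ v i) ∪ W).card := by
  constructor
  · rintro ⟨v', hB, hwin⟩
    refine ⟨univ.filter (fun i => v' i ≠ v i), hB, fun c _ => ?_⟩
    refine (card_le_card fun i hi => ?_).trans ((hwin c).trans (card_le_card fun i hi => ?_))
    · simp only [mem_filter, mem_univ, true_and, not_not] at hi ⊢
      exact hi.1 ▸ hi.2
    · simp only [mem_union, mem_filter, mem_univ, true_and] at hi ⊢
      by_cases h : v' i = v i
      · exact Or.inl (h ▸ hi)
      · exact Or.inr h
  · rintro ⟨W, hB, hwin⟩
    refine ⟨fun i => if i ∈ W then {p} else v i,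
      (sum_le_sum_of_subset fun i hi => ?_).trans hB, fun c => ?_⟩
    · by_contra hiW
      simp [hiW] at hi
    · obtain rfl | hc := eq_or_ne c p
      · exact le_rfl
      · refine (card_le_card fun i hi => ?_).trans
          ((hwin c hc).trans (card_le_card fun i hi => ?_))
        · by_cases hiW : i ∈ W <;> simp_all
        · by_cases hiW : i ∈ W <;> simp_all
end

section
/- Let C be a finite type with a distinguished candidate p : C, let n B : ℕ, let v : Fin n → Finset C (the approval sets of the voters), and let ω : Fin n → ℕ (the voter weights). Then the following are equivalent: (1) there exists a set D ⊆ Fin n with |D| ≤ B such that for every c : C, ∑_{i ∉ D, c ∈ v i} ω i ≤ ∑_{i ∉ D, p ∈ v i} ω i; (2) there exists a set D ⊆ Fin n with p ∉ v i for every i ∈ D, with |D| ≤ B, such that for every c : C, ∑_{i : c ∈ v i} ω i ≤ (∑_{i : p ∈ v i} ω i) + ∑_{i ∈ D, c ∈ v i} ω i. (Correctness of the reduction of Approval-Weighted-CCDV to Uniform Multiset Multicover.) -/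
open Finset

/-- The total weight of the voters satisfying `q` splits into the deleted and remaining parts. -/
theorem sum_filter_eq_sum_remaining_add_sum_deleted {ι M : Type*} [Fintype ι] [DecidableEq ι]
    [AddCommMonoid M] (D : Finset ι) (q : ι → Prop) [DecidablePred q] (ω : ι → M) :
    ∑ i ∈ univ.filter q, ω i =
      ∑ i ∈ univ.filter (fun i => i ∉ D ∧ q i), ω i + ∑ i ∈ D.filter q, ω i := by
  rw [← sum_filter_not_add_sum_filter (univ.filter q) (· ∈ D)]
  congr 2 <;> ext i <;> simp [and_comm]

/-- Correctness of the reduction of Approval-Weighted-CCDV to Uniform Multiset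
Multicover: it is never useful to delete voters who approve `p`. -/
theorem approval_weighted_ccdv_reduction (C : Type*) [Fintype C] [DecidableEq C] (p : C)
    (n B : ℕ) (v : Fin n → Finset C) (ω : Fin n → ℕ) :
    (∃ D : Finset (Fin n), D.card ≤ B ∧
        ∀ c : C, ∑ i ∈ univ.filter (fun i => i ∉ D ∧ c ∈ v i), ω i ≤
          ∑ i ∈ univ.filter (fun i => i ∉ D ∧ p ∈ v i), ω i) ↔
      ∃ D : Finset (Fin n), (∀ i ∈ D, p ∉ v i) ∧ D.card ≤ B ∧
        ∀ c : C, ∑ i ∈ univ.filter (fun i => c ∈ v i), ω i ≤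
          (∑ i ∈ univ.filter (fun i => p ∈ v i), ω i) +
            ∑ i ∈ D.filter (fun i => c ∈ v i), ω i := by
  constructor
  · rintro ⟨D, hD, h⟩
    refine ⟨D.filter (fun i => p ∉ v i), fun i hi => (mem_filter.1 hi).2,
      (card_filter_le _ _).trans hD, fun c => ?_⟩
    rw [sum_filter_eq_sum_remaining_add_sum_deleted D (fun i => c ∈ v i),
      sum_filter_eq_sum_remaining_add_sum_deleted D (fun i => p ∈ v i), add_assoc]
    refine add_le_add (h c) ?_
    simp only [filter_filter, sum_filter, ← sum_add_distrib]
    refine sum_le_sum fun i _ => ?_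
    by_cases hp : p ∈ v i <;> simp [hp]
    split_ifs <;> simp
  · rintro ⟨D, hp, hD, h⟩
    refine ⟨D, hD, fun c => ?_⟩
    have hc := h c
    rw [sum_filter_eq_sum_remaining_add_sum_deleted D (fun i => c ∈ v i),
      sum_filter_eq_sum_remaining_add_sum_deleted D (fun i => p ∈ v i),
      filter_false_of_mem hp, sum_empty, add_zero] at hc
    exact Nat.le_of_add_le_add_right hc
end

section
/- Let ε be a real number with 0 < ε ≤ 1, let m ≥ 1 be a natural number, let Y ≥ 1 be a real number, and let a : Fin m → ℕ satisfy 1 ≤ a i for all i and a i ≤ Y^m · a j for all i, j. Then there exist a real β > 0 and V : Fin m → ℝ such that for every i: V i = k · (ε/2) for some natural number k, V i ≤ Y^m, and (1 − ε/2) · a i ≤ β · V i ≤ a i. (Multisets whose positive multiplicities differ by at most a factor Y^m can be approximated from below within factor 1 − ε/2 by a scaled vector whose entries lie on the grid {0, ε/2, ε, 3ε/2, …, Y^m}.) -/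
/-- Multisets whose positive multiplicities differ by at most a factor `Y^m` can be
approximated from below within factor `1 - ε/2` by a scaled vector whose entries lie
on the grid `{0, ε/2, ε, 3ε/2, …, Y^m}`. -/
theorem grid_approximation (ε : ℝ) (hε : 0 < ε) (hε1 : ε ≤ 1) (m : ℕ) (hm : 1 ≤ m)
    (Y : ℝ) (hY : 1 ≤ Y) (a : Fin m → ℕ) (ha : ∀ i, 1 ≤ a i)
    (haY : ∀ i j, (a i : ℝ) ≤ Y ^ m * (a j : ℝ)) :
    ∃ (β : ℝ) (V : Fin m → ℝ), 0 < β ∧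
      ∀ i : Fin m,
        (∃ k : ℕ, V i = (k : ℝ) * (ε / 2)) ∧
        V i ≤ Y ^ m ∧
        (1 - ε / 2) * (a i : ℝ) ≤ β * V i ∧ β * V i ≤ (a i : ℝ) := by
  have : Nonempty (Fin m) := ⟨⟨0, hm⟩⟩
  obtain ⟨j, hj⟩ := Finite.exists_min a
  have hb : (0 : ℝ) < a j := by exact_mod_cast ha j
  have hδ : 0 < ε / 2 := by positivity
  refine ⟨a j, fun i => (⌊(a i : ℝ) / a j / (ε / 2)⌋₊ : ℝ) * (ε / 2), hb, fun i => ?_⟩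
  have hle : (⌊(a i : ℝ) / a j / (ε / 2)⌋₊ : ℝ) * (ε / 2) ≤ a i / a j :=
    (le_div_iff₀ hδ).1 (Nat.floor_le (by positivity))
  have hlt : (a i : ℝ) / a j < (⌊(a i : ℝ) / a j / (ε / 2)⌋₊ + 1) * (ε / 2) :=
    (div_lt_iff₀ hδ).1 (Nat.lt_floor_add_one _)
  refine ⟨⟨_, rfl⟩, hle.trans ((div_le_iff₀ hb).2 (haY i j)), ?_, ?_⟩
  · have hij : (a j : ℝ) ≤ a i := by exact_mod_cast hj i
    have hmul := (div_lt_iff₀ hb).1 hlt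
    have hround := mul_le_mul_of_nonneg_right hij hδ.le
    linarith
  · rw [mul_comm]
    exact (le_div_iff₀ hb).1 hle
end

section
/- Let n B : ℕ, let τ be a finite type, let t : Fin n → τ (assigning each item a type), let π : Fin n → ℕ (prices), and let P : (τ → ℕ) → Prop be an arbitrary predicate on type-count vectors. For σ : τ and k ≤ |{i | t i = σ}|, let f σ k be the minimum of ∑_{i ∈ D} π i over sets D ⊆ {i | t i = σ} with |D| = k. Then the following are equivalent: (1) there exists a set D ⊆ Fin n with ∑_{i ∈ D} π i ≤ B and P (fun σ => |{i ∈ D | t i = σ}|); (2) there exists z : τ → ℕ with z σ ≤ |{i | t i = σ}| for every σ, ∑_{σ} f σ (z σ) ≤ B, and P z. (Exchange lemma: if feasibility depends only on how many items of each type are selected, then it suffices to select, for each type, the cheapest items of that type; this underlies the paper's FPT results for priced control and bribery problems parameterized by the number of candidates.) -/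
open Finset

/-- Exchange lemma: if feasibility depends only on how many items of each type are
selected, then it suffices to select, for each type, the cheapest items of that type. -/
theorem cheapest_per_type_exchange (n B : ℕ) (τ : Type*) [Fintype τ] [DecidableEq τ]
    (t : Fin n → τ) (π : Fin n → ℕ) (P : (τ → ℕ) → Prop) (f : τ → ℕ → ℕ)
    (hf : ∀ (σ : τ) (k : ℕ), k ≤ (univ.filter fun i => t i = σ).card →
      IsLeast {s : ℕ | ∃ D : Finset (Fin n),
        D ⊆ univ.filter (fun i => t i = σ) ∧ D.card = k ∧ ∑ i ∈ D, π i = s} (f σ k)) :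
    (∃ D : Finset (Fin n), ∑ i ∈ D, π i ≤ B ∧
        P (fun σ => (D.filter fun i => t i = σ).card)) ↔
      ∃ z : τ → ℕ, (∀ σ : τ, z σ ≤ (univ.filter fun i => t i = σ).card) ∧
        (∑ σ : τ, f σ (z σ)) ≤ B ∧ P z := by
  constructor
  · rintro ⟨D, hD, hP⟩
    have hsub (σ : τ) : (D.filter fun i => t i = σ) ⊆ univ.filter fun i => t i = σ :=
      filter_subset_filter _ (subset_univ D)
    refine ⟨_, fun σ => card_le_card (hsub σ), le_trans ?_ hD, hP⟩
    rw [← sum_fiberwise D t π]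
    exact sum_le_sum fun σ _ => (hf σ _ (card_le_card (hsub σ))).2 ⟨_, hsub σ, rfl, rfl⟩
  · rintro ⟨z, hz, hB, hP⟩
    choose S hS hcard hsum using fun σ => (hf σ (z σ) (hz σ)).1
    have hfiber (σ : τ) :
        ((univ.filter fun i => i ∈ S (t i)).filter fun i => t i = σ) = S σ := by
      ext i
      have hi : i ∈ S σ → t i = σ := fun h => (mem_filter.1 (hS σ h)).2
      simp only [mem_filter, mem_univ, true_and]
      exact ⟨fun ⟨h, ht⟩ => ht ▸ h, fun h => ⟨(hi h).symm ▸ h, hi h⟩⟩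
    refine ⟨univ.filter fun i => i ∈ S (t i), ?_, ?_⟩
    · rw [← sum_fiberwise _ t π]
      simpa only [hfiber, hsum] using hB
    · simpa only [hfiber, hcard] using hP
end
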